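/- arXiv:2407.09948 — 9 statements merged into one kernel-verified Lean document; each statement's English description precedes it below -/
import Mathlib

section
/- Assume that for every time slot t ∈ Fin T, 0 < w̃* t and, for every user i, w̃* t ≤ g_N · (ν^max i / g i). Then ν* i is admissible for every user i, the profile ν* is a strict Nash equilibrium of the box-constrained game, and ν* is the unique Nash equilibrium: every profile with all components admissible that satisfies the Nash-equilibrium property equals ν*. -/
/-- The change of a user's cost when that user moves from `ν i` to a strategy `x` of the same
total: a first-order term and a quadratic term in `x - ν i`. -/
lemma sum_cost_update_sub {ι τ : Type*} [Fintype ι] [DecidableEq ι] [Fintype τ]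
    (c : ℝ) (W : τ → ℝ) (ν : ι → τ → ℝ) (i : ι) (x : τ → ℝ) (hx : ∑ t, x t = ∑ t, ν i t) :
    ∑ t, (c + (∑ j, Function.update ν i x j t) / W t) * Function.update ν i x i t
      - ∑ t, (c + (∑ j, ν j t) / W t) * ν i t
    = ∑ t, (∑ j, ν j t + ν i t) / W t * (x t - ν i t) + ∑ t, (x t - ν i t) ^ 2 / W t := by
  have htotal : ∀ t, ∑ j, Function.update ν i x j t = ∑ j, ν j t + (x t - ν i t) := by
    intro t
    have hterm : ∀ j, Function.update ν i x j t
        = ν j t + if j = i then x t - ν i t else 0 := by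
      intro j
      by_cases h : j = i
      · subst h; simp
      · simp [h]
    simp [hterm, Finset.sum_add_distrib]
  have hconst : ∑ t, c * (x t - ν i t) = 0 := by
    rw [← Finset.mul_sum, Finset.sum_sub_distrib, hx, sub_self, mul_zero]
  rw [← add_zero (_ + _), ← hconst, ← Finset.sum_sub_distrib, ← Finset.sum_add_distrib,
    ← Finset.sum_add_distrib]
  refine Finset.sum_congr rfl fun t _ => ?_
  rw [htotal, Function.update_self]
  ring

lemma nonneg_of_forall_linear_add_quadratic_nonneg {a b : ℝ}
    (h : ∀ ε : ℝ, 0 < ε → ε ≤ 1 → 0 ≤ ε * a + ε ^ 2 * b) : 0 ≤ a := by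
  by_contra! ha
  have hb : 0 < |b| - a := by linarith [abs_nonneg b]
  have hε : 0 < -a / (2 * (|b| - a)) := by apply div_pos <;> linarith
  have hε' : -a / (2 * (|b| - a)) ≤ 1 := by
    rw [div_le_one (by linarith)]
    linarith [abs_nonneg b]
  have hmul : -a / (2 * (|b| - a)) * (|b| - a) = -a / 2 := by field_simp
  have hval := h _ hε hε'
  set ε := -a / (2 * (|b| - a))
  have hfactor : 0 ≤ a + ε * b := by
    refine nonneg_of_mul_nonneg_right (a := ε) ?_ hε
    linarith [show ε * (a + ε * b) = ε * a + ε ^ 2 * b by ring]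
  nlinarith [le_abs_self b]

/-- Under the conditions `0 < w̃* t` and `w̃* t ≤ g_N · (ν^max i / g i)`,
the profile `ν* i t = (g i / g_N) · w̃* t` is admissible for every user, is a strict
Nash equilibrium of the box-constrained game, and is its unique Nash equilibrium. -/
theorem stmt0
    (n T : ℕ) (hn : 1 ≤ n) (hT : 1 ≤ T)
    (w r : Fin T → ℝ) (g : Fin n → ℝ) (hg : ∀ i, 0 < g i)
    (νmax : Fin n → ℝ)
    (gN : ℝ) (hgN : gN = ∑ i, g i)
    (wst : Fin T → ℝ)
    (hwst : ∀ t, wst t = gN / (T : ℝ) + w t - r t + (1 / (T : ℝ)) * ∑ s, (r s - w s))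
    (Adm : Fin n → (Fin T → ℝ) → Prop)
    (hAdm : ∀ i x, Adm i x ↔ ((∑ t, x t = g i) ∧ ∀ t, 0 ≤ x t ∧ x t ≤ νmax i))
    (cost : Fin n → (Fin n → Fin T → ℝ) → ℝ)
    (hcost : ∀ i ν, cost i ν = ∑ t, (1 + 1 / (n : ℝ) + (∑ j, ν j t) / wst t) * ν i t)
    (νstar : Fin n → Fin T → ℝ)
    (hνstar : ∀ i t, νstar i t = (g i / gN) * wst t)
    (hpos : ∀ t, 0 < wst t)
    (hbound : ∀ t (i : Fin n), wst t ≤ gN * (νmax i / g i)) :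
    (∀ i, Adm i (νstar i)) ∧
    (∀ i x, Adm i x → x ≠ νstar i →
      cost i (Function.update νstar i x) > cost i νstar) ∧
    (∀ ν : Fin n → Fin T → ℝ,
      (∀ i, Adm i (ν i)) →
      (∀ i x, Adm i x → cost i (Function.update ν i x) ≥ cost i ν) →
      ν = νstar) := by
  have hT' : (T : ℝ) ≠ 0 := by positivity
  have hgN_pos : 0 < gN := hgN ▸ Finset.sum_pos (fun i _ => hg i) ⟨⟨0, hn⟩, Finset.mem_univ _⟩
  have hwsum : ∑ t, wst t = gN := by
    simp only [hwst, Finset.sum_add_distrib, Finset.sum_sub_distrib, Finset.sum_const,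
      Finset.card_univ, Fintype.card_fin, nsmul_eq_mul]
    field_simp
    ring
  have hstar_total : ∀ t, ∑ j, νstar j t = wst t := by
    intro t
    simp only [hνstar]
    rw [← Finset.sum_mul, ← Finset.sum_div, ← hgN, div_self hgN_pos.ne', one_mul]
  have hstar_adm : ∀ i, Adm i (νstar i) := by
    intro i
    have hgi := hg i
    refine (hAdm _ _).2 ⟨?_, fun t => ?_⟩
    · simp only [hνstar]
      rw [← Finset.mul_sum, hwsum, div_mul_cancel₀ _ hgN_pos.ne']
    · have hwt := hpos t
      rw [hνstar]
      refine ⟨by positivity, ?_⟩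
      calc g i / gN * wst t ≤ g i / gN * (gN * (νmax i / g i)) := by
            gcongr
            exact hbound t i
        _ = νmax i := by field_simp
  have hcost_sub : ∀ ν i x, Adm i (ν i) → Adm i x →
      cost i (Function.update ν i x) - cost i ν
        = ∑ t, (∑ j, ν j t + ν i t) / wst t * (x t - ν i t)
          + ∑ t, (x t - ν i t) ^ 2 / wst t := by
    intro ν i x hν hx
    rw [hcost, hcost]
    exact sum_cost_update_sub _ _ _ _ _ (((hAdm _ _).1 hx).1.trans ((hAdm _ _).1 hν).1.symm)
  refine ⟨hstar_adm, fun i x hx hne => ?_, fun ν hν hnash => ?_⟩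
  · have hlin : ∑ t, (∑ j, νstar j t + νstar i t) / wst t * (x t - νstar i t) = 0 := by
      have hmarginal : ∀ t, (∑ j, νstar j t + νstar i t) / wst t = 1 + g i / gN := by
        intro t
        have hwt := (hpos t).ne'
        rw [hstar_total, hνstar]
        field_simp
      simp only [hmarginal]
      rw [← Finset.mul_sum, Finset.sum_sub_distrib, ((hAdm _ _).1 hx).1,
        ((hAdm _ _).1 (hstar_adm i)).1, sub_self, mul_zero]
    obtain ⟨t, ht⟩ := Function.ne_iff.1 hne
    have hquad : 0 < ∑ s, (x s - νstar i s) ^ 2 / wst s :=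
      Finset.sum_pos' (fun s _ => div_nonneg (sq_nonneg _) (hpos s).le)
        ⟨t, Finset.mem_univ _, div_pos (sq_pos_of_ne_zero (sub_ne_zero.2 ht)) (hpos t)⟩
    linarith [hcost_sub νstar i x (hstar_adm i) hx]
  · have hvar : ∀ i, 0 ≤ ∑ t, (∑ j, ν j t + ν i t) / wst t * (νstar i t - ν i t) := by
      intro i
      refine nonneg_of_forall_linear_add_quadratic_nonneg
        (b := ∑ t, (νstar i t - ν i t) ^ 2 / wst t) fun ε hε hε' => ?_
      obtain ⟨hνsum, hνbox⟩ := (hAdm _ _).1 (hν i)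
      obtain ⟨hstar_sum, hstar_box⟩ := (hAdm _ _).1 (hstar_adm i)
      have hx : Adm i (fun t => ν i t + ε * (νstar i t - ν i t)) := by
        refine (hAdm _ _).2 ⟨?_, fun t => ?_⟩
        · rw [Finset.sum_add_distrib, ← Finset.mul_sum, Finset.sum_sub_distrib, hνsum, hstar_sum]
          ring
        · obtain ⟨h₁, h₂⟩ := hνbox t
          obtain ⟨h₃, h₄⟩ := hstar_box t
          constructor <;> nlinarith
      have hsub := hcost_sub ν i _ (hν i) hx
      have hle := hnash i _ hx
      have heq : ε * ∑ t, (∑ j, ν j t + ν i t) / wst t * (νstar i t - ν i t)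
          + ε ^ 2 * ∑ t, (νstar i t - ν i t) ^ 2 / wst t
          = ∑ t, (∑ j, ν j t + ν i t) / wst t * (ν i t + ε * (νstar i t - ν i t) - ν i t)
          + ∑ t, (ν i t + ε * (νstar i t - ν i t) - ν i t) ^ 2 / wst t := by
        rw [Finset.mul_sum, Finset.mul_sum]
        congr 1 <;> exact Finset.sum_congr rfl fun t _ => by ring
      linarith
    have hdiff : ∀ i, ∑ t, (∑ j, ν j t + ν i t) / wst t * (νstar i t - ν i t)
        = ∑ t, (∑ j, ν j t - wst t) / wst t * (νstar i t - ν i t)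
          - ∑ t, (ν i t - νstar i t) ^ 2 / wst t := by
      intro i
      have hconst : ∑ t, (1 + g i / gN) * (νstar i t - ν i t) = 0 := by
        rw [← Finset.mul_sum, Finset.sum_sub_distrib, ((hAdm _ _).1 (hν i)).1,
          ((hAdm _ _).1 (hstar_adm i)).1, sub_self, mul_zero]
      rw [← add_zero (_ - _), ← hconst, ← Finset.sum_sub_distrib, ← Finset.sum_add_distrib]
      refine Finset.sum_congr rfl fun t _ => ?_
      have hwt := (hpos t).ne'
      rw [hνstar]
      field_simp
      ring
    have htotal : ∑ i, ∑ t, (∑ j, ν j t - wst t) / wst t * (νstar i t - ν i t)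
        = - ∑ t, (∑ j, ν j t - wst t) ^ 2 / wst t := by
      rw [Finset.sum_comm, ← Finset.sum_neg_distrib]
      refine Finset.sum_congr rfl fun t _ => ?_
      rw [← Finset.mul_sum, Finset.sum_sub_distrib, hstar_total]
      ring
    have hagg : 0 ≤ ∑ t, (∑ j, ν j t - wst t) ^ 2 / wst t :=
      Finset.sum_nonneg fun t _ => div_nonneg (sq_nonneg _) (hpos t).le
    have hsum := Finset.sum_nonneg fun i (_ : i ∈ Finset.univ) => hvar i
    simp only [hdiff] at hsum
    rw [Finset.sum_sub_distrib, htotal] at hsum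
    funext i t
    by_contra hne
    have hterm : ∀ j s, 0 ≤ (ν j s - νstar j s) ^ 2 / wst s :=
      fun j s => div_nonneg (sq_nonneg _) (hpos s).le
    have hquad : 0 < ∑ j, ∑ s, (ν j s - νstar j s) ^ 2 / wst s :=
      Finset.sum_pos' (fun j _ => Finset.sum_nonneg fun s _ => hterm j s)
        ⟨i, Finset.mem_univ _, Finset.sum_pos' (fun s _ => hterm i s)
          ⟨t, Finset.mem_univ _, div_pos (sq_pos_of_ne_zero (sub_ne_zero.2 hne)) (hpos t)⟩⟩
    linarith
end

section
/- If g_N + T·δ ≠ 0, then the utility company's cost under the profile σ satisfies (1/T) · ∑_t (c t − c̄)² = (T·δ/(g_N + T·δ))² · Var(w − r). -/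
/-- The empirical variance of an affine image of a finite sample scales by the square of the
slope. -/
theorem mean_sq_sub_mean_affine {T : ℕ} (hT : (T : ℝ) ≠ 0) (x y : Fin T → ℝ) (a k : ℝ)
    (hy : ∀ t, y t = a * x t + k) :
    (1 / (T : ℝ)) * ∑ t, (y t - (1 / (T : ℝ)) * ∑ s, y s) ^ 2 =
      a ^ 2 * ((1 / (T : ℝ)) * ∑ t, (x t - (1 / (T : ℝ)) * ∑ s, x s) ^ 2) := by
  have hmean : (1 / (T : ℝ)) * ∑ s, y s = a * ((1 / (T : ℝ)) * ∑ s, x s) + k := by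
    simp only [hy, Finset.sum_add_distrib, ← Finset.mul_sum, Finset.sum_const,
      Finset.card_univ, Fintype.card_fin, nsmul_eq_mul]
    field_simp
  rw [hmean, mul_left_comm (a ^ 2), Finset.mul_sum _ _ (a ^ 2)]
  congr 1
  refine Finset.sum_congr rfl fun t _ => ?_
  rw [hy]
  ring

/-- If `g_N + T·δ ≠ 0`, the utility company's cost under the profile
`σ i t = (g i/(g_N + T·δ))·w⌢ t` equals `(T·δ/(g_N + T·δ))² · Var(w − r)`. -/
theorem stmt4
    (n T : ℕ) (hn : 1 ≤ n) (hT : 1 ≤ T)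
    (w r : Fin T → ℝ) (g : Fin n → ℝ) (hg : ∀ i, 0 < g i)
    (gN : ℝ) (hgN : gN = ∑ i, g i)
    (b : ℝ) (δ : ℝ) (hδ : δ = b - (1 / (T : ℝ)) * ∑ s, (r s - w s))
    (wfr : Fin T → ℝ)
    (hwfr : ∀ t, wfr t = w t - r t + gN / (T : ℝ) + b)
    (σ : Fin n → Fin T → ℝ)
    (hσ : ∀ i t, σ i t = (g i / (gN + (T : ℝ) * δ)) * wfr t)
    (c : Fin T → ℝ)
    (hc : ∀ t, c t = (∑ i, σ i t) + r t - w t)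
    (cbar : ℝ) (hcbar : cbar = (1 / (T : ℝ)) * ∑ t, c t)
    (V : ℝ)
    (hV : V = (1 / (T : ℝ)) *
      ∑ t, (w t - r t - (1 / (T : ℝ)) * ∑ s, (w s - r s)) ^ 2)
    (hne : gN + (T : ℝ) * δ ≠ 0) :
    (1 / (T : ℝ)) * ∑ t, (c t - cbar) ^ 2 =
      ((T : ℝ) * δ / (gN + (T : ℝ) * δ)) ^ 2 * V := by
  have hT0 : (T : ℝ) ≠ 0 := Nat.cast_ne_zero.mpr (by omega)
  have hc_affine : ∀ t, c t = -((T : ℝ) * δ / (gN + (T : ℝ) * δ)) * (w t - r t) +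
      gN / (gN + (T : ℝ) * δ) * (gN / (T : ℝ) + b) := by
    intro t
    simp only [hc, hσ, hwfr, ← Finset.sum_mul, ← Finset.sum_div, ← hgN]
    field_simp
    ring
  rw [hcbar, hV, mean_sq_sub_mean_affine hT0 (fun t => w t - r t) c _ _ hc_affine, neg_sq]
end

section
/- Assume w̃ t > 0 for every t ∈ Fin T. Then ν* is feasible and is a strict Nash equilibrium of the equality-constrained game: for every user i and every x : Fin T → ℝ with ∑_t x t = g i and x ≠ ν* i, replacing ν* i by x strictly increases user i's cost. -/
/-- A profile at which user `i`'s marginal cost takes the same value `c` at every time is the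
strict best response of user `i` among strategies with the same total demand. -/
theorem cost_lt_cost_update_of_marginal_const {ι τ : Type*} [Fintype ι] [DecidableEq ι] [Fintype τ]
    {w r : τ → ℝ} (hw : ∀ t, 0 < w t) {ν : ι → τ → ℝ} {i : ι} {c : ℝ}
    (hc : ∀ t, (∑ j, ν j t) + r t + ν i t = c * w t)
    {x : τ → ℝ} (hsum : ∑ t, x t = ∑ t, ν i t) (hx : x ≠ ν i) :
    ∑ t, (((∑ j, ν j t) + r t) / w t) * ν i t <
      ∑ t, (((∑ j, Function.update ν i x j t) + r t) / w t) * Function.update ν i x i t := by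
  have hupdate (t : τ) : ∑ j, Function.update ν i x j t = (∑ j, ν j t) + (x t - ν i t) := by
    have hcongr : ∑ j ∈ Finset.univ.erase i, Function.update ν i x j t =
        ∑ j ∈ Finset.univ.erase i, ν j t :=
      Finset.sum_congr rfl fun j hj => by
        rw [Function.update_of_ne (Finset.ne_of_mem_erase hj)]
    rw [← Finset.add_sum_erase _ _ (Finset.mem_univ i), hcongr,
      ← Finset.add_sum_erase _ (fun j => ν j t) (Finset.mem_univ i), Function.update_self]
    ring
  have hterm (t : τ) :
      (((∑ j, Function.update ν i x j t) + r t) / w t) * Function.update ν i x i t =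
        (((∑ j, ν j t) + r t) / w t) * ν i t +
          (c * (x t - ν i t) + (x t - ν i t) ^ 2 / w t) := by
    have hne := (hw t).ne'
    rw [hupdate, Function.update_self]
    field_simp
    linear_combination (x t - ν i t) * hc t
  have hlin : ∑ t, c * (x t - ν i t) = 0 := by
    rw [← Finset.mul_sum, Finset.sum_sub_distrib, hsum, sub_self, mul_zero]
  have hquad : 0 < ∑ t, (x t - ν i t) ^ 2 / w t := by
    obtain ⟨t, ht⟩ := Function.ne_iff.mp hx
    exact Finset.sum_pos' (fun s _ => div_nonneg (sq_nonneg _) (hw s).le)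
      ⟨t, Finset.mem_univ t, div_pos (sq_pos_of_ne_zero (sub_ne_zero.mpr ht)) (hw t)⟩
  rw [Finset.sum_congr rfl fun t _ => hterm t, Finset.sum_add_distrib, Finset.sum_add_distrib,
    hlin, zero_add]
  exact lt_add_of_pos_right _ hquad

/-- If `w̃ t > 0` for all `t`, the profile
`ν* i t = (g i / W)·w̃ t + (R·w̃ t − W·r̃ t)/((n+1)·W)` is feasible and is a strict
Nash equilibrium of the equality-constrained game. -/
theorem stmt5
    (n T : ℕ) (hn : 1 ≤ n) (hT : 1 ≤ T)
    (wt rt : Fin T → ℝ) (g : Fin n → ℝ) (hg : ∀ i, 0 < g i)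
    (gN W R : ℝ) (hgN : gN = ∑ i, g i) (hW : W = ∑ t, wt t) (hR : R = ∑ t, rt t)
    (cost : Fin n → (Fin n → Fin T → ℝ) → ℝ)
    (hcost : ∀ i ν, cost i ν = ∑ t, (((∑ j, ν j t) + rt t) / wt t) * ν i t)
    (νstar : Fin n → Fin T → ℝ)
    (hνstar : ∀ i t, νstar i t =
      (g i / W) * wt t + (R * wt t - W * rt t) / (((n : ℝ) + 1) * W))
    (hpos : ∀ t, 0 < wt t) :
    (∀ i, ∑ t, νstar i t = g i) ∧
    (∀ i (x : Fin T → ℝ), (∑ t, x t = g i) → x ≠ νstar i →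
      cost i (Function.update νstar i x) > cost i νstar) := by
  have : Nonempty (Fin T) := ⟨⟨0, hT⟩⟩
  have hWpos : 0 < W := hW ▸ Finset.sum_pos (fun t _ => hpos t) Finset.univ_nonempty
  have hWne := hWpos.ne'
  have hn1 : (n : ℝ) + 1 ≠ 0 := by positivity
  have hfeas (i : Fin n) : ∑ t, νstar i t = g i := by
    simp only [hνstar]
    rw [Finset.sum_add_distrib, ← Finset.mul_sum, ← Finset.sum_div, Finset.sum_sub_distrib,
      ← Finset.mul_sum, ← Finset.mul_sum, ← hW, ← hR]
    field_simp
    ring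
  refine ⟨hfeas, fun i x hx hne => ?_⟩
  rw [gt_iff_lt, hcost, hcost]
  refine cost_lt_cost_update_of_marginal_const (c := (gN + g i + R) / W) hpos (fun t => ?_)
    (hx.trans (hfeas i).symm) hne
  simp only [hνstar]
  rw [Finset.sum_add_distrib, ← Finset.sum_mul, ← Finset.sum_div, ← hgN, Finset.sum_const,
    Finset.card_univ, Fintype.card_fin, nsmul_eq_mul]
  field_simp
  ring
end

section
/- Assume w̃ t > 0 for every t ∈ Fin T. Then ν* is the unique Nash equilibrium of the equality-constrained game: every feasible profile satisfying the Nash-equilibrium property equals ν*. -/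
/-- A minimizer `y` of `x ↦ ∑ t, ((a t + x t) / w t) * x t` among the `x` with the same total as `y`
equalizes the marginal costs `(a t + 2 * y t) / w t`. -/
theorem marginal_cost_eq_of_minimizer {ι : Type*} [Fintype ι] {w a y : ι → ℝ}
    (hw : ∀ t, 0 < w t)
    (hmin : ∀ x : ι → ℝ, ∑ t, x t = ∑ t, y t →
      ∑ t, ((a t + y t) / w t) * y t ≤ ∑ t, ((a t + x t) / w t) * x t) (t : ι) :
    a t + 2 * y t = (∑ s, (a s + 2 * y s)) / (∑ s, w s) * w t := by
  have hW : 0 < ∑ s, w s := Finset.sum_pos (fun s _ => hw s) ⟨t, Finset.mem_univ t⟩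
  set c := (∑ s, (a s + 2 * y s)) / (∑ s, w s) with hc
  set d : ι → ℝ := fun s => a s + 2 * y s - c * w s with hd
  have hd_sum : ∑ s, d s = 0 := by
    simp only [hd]
    rw [Finset.sum_sub_distrib, ← Finset.mul_sum, hc, div_mul_cancel₀ _ hW.ne', sub_self]
  have hx := hmin (fun s => y s - 1 / 2 * d s) (by
    rw [Finset.sum_sub_distrib, ← Finset.mul_sum, hd_sum]; ring)
  have hdiff : ∑ s, ((a s + (y s - 1 / 2 * d s)) / w s) * (y s - 1 / 2 * d s) =
      ∑ s, ((a s + y s) / w s) * y s - 1 / 4 * ∑ s, d s ^ 2 / w s - c / 2 * ∑ s, d s := by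
    rw [Finset.mul_sum, Finset.mul_sum, ← Finset.sum_sub_distrib, ← Finset.sum_sub_distrib]
    refine Finset.sum_congr rfl fun s _ => ?_
    have := (hw s).ne'
    simp only [hd]
    field_simp
    ring
  rw [hdiff, hd_sum] at hx
  have hnonneg : ∀ s ∈ Finset.univ, 0 ≤ d s ^ 2 / w s :=
    fun s _ => div_nonneg (sq_nonneg _) (hw s).le
  have hzero : ∑ s, d s ^ 2 / w s = 0 :=
    le_antisymm (by linarith) (Finset.sum_nonneg hnonneg)
  have ht := (Finset.sum_eq_zero_iff_of_nonneg hnonneg).1 hzero t (Finset.mem_univ t)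
  have hdt : d t = 0 := by simpa [(hw t).ne'] using ht
  exact sub_eq_zero.1 hdt

/-- If `w̃ t > 0` for all `t`, then
`ν* i t = (g i / W)·w̃ t + (R·w̃ t − W·r̃ t)/((n+1)·W)` is the unique Nash equilibrium
of the equality-constrained game: every feasible profile satisfying the
Nash-equilibrium property equals `ν*`. -/
theorem stmt6
    (n T : ℕ) (hn : 1 ≤ n) (hT : 1 ≤ T)
    (wt rt : Fin T → ℝ) (g : Fin n → ℝ) (hg : ∀ i, 0 < g i)
    (gN W R : ℝ) (hgN : gN = ∑ i, g i) (hW : W = ∑ t, wt t) (hR : R = ∑ t, rt t)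
    (cost : Fin n → (Fin n → Fin T → ℝ) → ℝ)
    (hcost : ∀ i ν, cost i ν = ∑ t, (((∑ j, ν j t) + rt t) / wt t) * ν i t)
    (νstar : Fin n → Fin T → ℝ)
    (hνstar : ∀ i t, νstar i t =
      (g i / W) * wt t + (R * wt t - W * rt t) / (((n : ℝ) + 1) * W))
    (hpos : ∀ t, 0 < wt t) :
    ∀ ν : Fin n → Fin T → ℝ,
      (∀ i, ∑ t, ν i t = g i) →
      (∀ i (x : Fin T → ℝ), (∑ t, x t = g i) →
        cost i (Function.update ν i x) ≥ cost i ν) →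
      ν = νstar := by
  intro ν hfeas hnash
  have hfoc : ∀ i t, (∑ j, ν j t) + rt t + ν i t = (gN + R + g i) / W * wt t := by
    intro i t
    have hsum : ∀ x : Fin T → ℝ, ∀ s,
        ∑ j, Function.update ν i x j s = (∑ j, ν j s) - ν i s + x s := by
      intro x s
      rw [← Finset.add_sum_erase _ _ (Finset.mem_univ i),
        ← Finset.add_sum_erase _ (fun j => ν j s) (Finset.mem_univ i),
        Finset.sum_congr rfl fun j hj => by rw [Function.update_of_ne (Finset.ne_of_mem_erase hj)],
        Function.update_self]
      ring
    have h := marginal_cost_eq_of_minimizer (a := fun s => (∑ j, ν j s) - ν i s + rt s)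
      (y := ν i) hpos (fun x hx => by
        have hdev := hnash i x (hx.trans (hfeas i))
        simp only [hcost, hsum, Function.update_self] at hdev
        refine (le_of_eq ?_).trans (hdev.trans (le_of_eq ?_)) <;>
          exact Finset.sum_congr rfl fun s _ => by ring) t
    have htotal : ∑ s, ((∑ j, ν j s) - ν i s + rt s + 2 * ν i s) = gN + R + g i := by
      have hcomm : ∑ s, ∑ j, ν j s = gN := by
        rw [Finset.sum_comm, hgN]
        exact Finset.sum_congr rfl fun j _ => hfeas j
      rw [← hcomm, hR, ← hfeas i, ← Finset.sum_add_distrib, ← Finset.sum_add_distrib]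
      exact Finset.sum_congr rfl fun s _ => by ring
    rw [htotal, ← hW] at h
    linarith
  funext i t
  have hW_pos : 0 < W := hW ▸ Finset.sum_pos (fun s _ => hpos s) ⟨t, Finset.mem_univ t⟩
  have hn_pos : (0 : ℝ) < (n : ℝ) + 1 := by positivity
  have hagg : n * ((∑ j, ν j t) + rt t) + ∑ j, ν j t
      = (n * (gN + R) + gN) / W * wt t := by
    have h := Finset.sum_congr rfl fun j (_ : j ∈ Finset.univ) => hfoc j t
    rw [← Finset.sum_mul, ← Finset.sum_div] at h
    simp only [Finset.sum_add_distrib, ← hgN, Finset.sum_const, Finset.card_univ,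
      Fintype.card_fin, nsmul_eq_mul] at h
    rwa [← mul_add, ← mul_add] at h
  have hi := hfoc i t
  rw [hνstar]
  field_simp at hi hagg ⊢
  linear_combination ((n : ℝ) + 1) * hi - hagg
end

section
/- Assume w̃ t > 0 for every t ∈ Fin T and ν^max i ≥ g i / T for every user i. Then the box-constrained game admits a Nash equilibrium, this Nash equilibrium is unique, and it is a strict Nash equilibrium. -/
open Finset

namespace BoxGame

variable {n T : ℕ}

theorem sum_comp_update {ι α : Type*} [Fintype ι] [DecidableEq ι]
    (ν : ι → α) (i : ι) (x : α) (f : α → ℝ) :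
    ∑ j, f (Function.update ν i x j) = ∑ j, f (ν j) + (f x - f (ν i)) := by
  rw [← add_sum_erase univ _ (mem_univ i),
    ← add_sum_erase univ (fun j => f (ν j)) (mem_univ i),
    sum_congr rfl fun j hj => by rw [Function.update_of_ne (ne_of_mem_erase hj)],
    Function.update_self]
  ring

/-- The cost of user `i` under the profile `ν`. -/
noncomputable def userCost (w r : Fin T → ℝ) (i : Fin n) (ν : Fin n → Fin T → ℝ) : ℝ :=
  ∑ t, (((∑ j, ν j t) + r t) / w t) * ν i t

/-- The directional derivative of the cost of user `i` in its own strategy, along `d`. -/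
noncomputable def userCostDeriv (w r : Fin T → ℝ) (i : Fin n) (ν : Fin n → Fin T → ℝ)
    (d : Fin T → ℝ) : ℝ :=
  ∑ t, ((∑ j, ν j t) + r t + ν i t) / w t * d t

/-- An exact potential of the game. -/
noncomputable def potential (w r : Fin T → ℝ) (ν : Fin n → Fin T → ℝ) : ℝ :=
  ∑ t, ((∑ j, ν j t) ^ 2 / 2 + r t * (∑ j, ν j t) + (∑ j, ν j t ^ 2) / 2) / w t

theorem userCost_update (w r : Fin T → ℝ) (i : Fin n) (ν : Fin n → Fin T → ℝ)
    (x : Fin T → ℝ) :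
    userCost w r i (Function.update ν i x) =
      userCost w r i ν + userCostDeriv w r i ν (x - ν i) + ∑ t, (x t - ν i t) ^ 2 / w t := by
  simp only [userCost, userCostDeriv, ← sum_add_distrib]
  refine sum_congr rfl fun t _ => ?_
  rw [sum_comp_update ν i x (fun y => y t), Function.update_self, Pi.sub_apply]
  ring

theorem potential_update (w r : Fin T → ℝ) (i : Fin n) (ν : Fin n → Fin T → ℝ)
    (x : Fin T → ℝ) :
    potential w r (Function.update ν i x) - potential w r ν =
      userCost w r i (Function.update ν i x) - userCost w r i ν := by
  simp only [potential, userCost, ← sum_sub_distrib]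
  refine sum_congr rfl fun t _ => ?_
  rw [sum_comp_update ν i x (fun y => y t), sum_comp_update ν i x (fun y => y t ^ 2),
    Function.update_self]
  ring

theorem continuous_potential (w r : Fin T → ℝ) :
    Continuous (potential w r : (Fin n → Fin T → ℝ) → ℝ) := by
  unfold potential
  fun_prop

/-- The strategies of total amount `a` with entries in `[0, b]`. -/
def strategies (T : ℕ) (a b : ℝ) : Set (Fin T → ℝ) :=
  {x | (∑ t, x t = a) ∧ ∀ t, 0 ≤ x t ∧ x t ≤ b}

theorem isCompact_strategies (a b : ℝ) : IsCompact (strategies T a b) := by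
  have h : strategies T a b = Set.Icc 0 (fun _ => b) ∩ {x | ∑ t, x t = a} := by
    ext x
    simp only [strategies, Set.mem_ofPred_eq, Set.mem_inter_iff, Set.mem_Icc, Pi.le_def,
      Pi.zero_apply, forall_and]
    tauto
  rw [h]
  exact isCompact_Icc.inter_right (isClosed_eq (by fun_prop) continuous_const)

theorem convex_strategies (a b : ℝ) : Convex ℝ (strategies T a b) := by
  rintro x ⟨hx, hx'⟩ y ⟨hy, hy'⟩ p q hp hq hpq
  refine ⟨?_, fun t => ?_⟩
  · simp only [Pi.add_apply, Pi.smul_apply, smul_eq_mul, sum_add_distrib, ← mul_sum, hx, hy]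
    rw [← add_mul, hpq, one_mul]
  · exact convex_Icc (0 : ℝ) b (hx' t) (hy' t) hp hq hpq

theorem strategies_nonempty {a b : ℝ} (hT : 1 ≤ T) (ha : 0 ≤ a) (hab : a / T ≤ b) :
    (strategies T a b).Nonempty := by
  have hT' : (T : ℝ) ≠ 0 := by positivity
  refine ⟨fun _ => a / T, ?_, fun _ => ⟨by positivity, hab⟩⟩
  simp [mul_div_cancel₀ _ hT']

/-- First-order optimality: no admissible direction decreases the cost at a best response. -/
theorem userCostDeriv_nonneg {w r : Fin T → ℝ} {i : Fin n} {ν : Fin n → Fin T → ℝ}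
    {s : Set (Fin T → ℝ)} (hs : Convex ℝ s) (hν : ν i ∈ s)
    (hmin : ∀ x ∈ s, userCost w r i ν ≤ userCost w r i (Function.update ν i x))
    {x : Fin T → ℝ} (hx : x ∈ s) : 0 ≤ userCostDeriv w r i ν (x - ν i) := by
  set A := userCostDeriv w r i ν (x - ν i) with hA
  set B := ∑ t, (x t - ν i t) ^ 2 / w t with hB
  have key : ∀ ε : ℝ, 0 < ε → ε ≤ 1 → 0 ≤ A + ε * B := by
    intro ε hε hε1
    have h := hmin _ (hs.add_smul_sub_mem hν hx ⟨hε.le, hε1⟩)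
    have hlin : userCostDeriv w r i ν (ν i + ε • (x - ν i) - ν i) = ε * A := by
      simp only [hA, userCostDeriv, mul_sum, add_sub_cancel_left, Pi.smul_apply, smul_eq_mul]
      exact sum_congr rfl fun t _ => by ring
    have hquad : ∑ t, ((ν i + ε • (x - ν i)) t - ν i t) ^ 2 / w t = ε * (ε * B) := by
      simp only [hB, mul_sum, Pi.add_apply, Pi.smul_apply, smul_eq_mul, Pi.sub_apply]
      exact sum_congr rfl fun t _ => by ring
    rw [userCost_update, hlin, hquad] at h
    exact nonneg_of_mul_nonneg_right (by linarith) hε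
  have hlim : Filter.Tendsto (fun ε : ℝ => A + ε * B) (nhdsWithin 0 (Set.Ioi 0)) (nhds A) := by
    have hc : Continuous fun ε : ℝ => A + ε * B := by fun_prop
    simpa using (hc.tendsto 0).mono_left nhdsWithin_le_nhds
  refine ge_of_tendsto hlim ?_
  filter_upwards [Ioc_mem_nhdsGT one_pos] with ε hε using key ε hε.1 hε.2

theorem sum_sq_div_pos {w : Fin T → ℝ} (hw : ∀ t, 0 < w t) {x y : Fin T → ℝ} (hxy : x ≠ y) :
    0 < ∑ t, (x t - y t) ^ 2 / w t := by
  obtain ⟨t, ht⟩ := Function.ne_iff.mp hxy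
  have := sub_ne_zero.mpr ht
  exact sum_pos' (fun t _ => div_nonneg (sq_nonneg _) (hw t).le)
    ⟨t, mem_univ t, div_pos (by positivity) (hw t)⟩

/-- The pseudo-gradient of the game is strongly monotone. -/
theorem sum_userCostDeriv_add (w r : Fin T → ℝ) (ν ν' : Fin n → Fin T → ℝ) :
    ∑ i, (userCostDeriv w r i ν (ν' i - ν i) + userCostDeriv w r i ν' (ν i - ν' i)) =
      -(∑ t, (∑ j, ν j t - ∑ j, ν' j t) ^ 2 / w t + ∑ i, ∑ t, (ν' i t - ν i t) ^ 2 / w t) := by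
  have h : ∀ t, (∑ j, ν j t - ∑ j, ν' j t) ^ 2 / w t =
      ∑ i, (∑ j, ν j t - ∑ j, ν' j t) * (ν i t - ν' i t) / w t := by
    intro t
    rw [← sum_div, ← mul_sum, sum_sub_distrib]
    ring
  simp only [h, userCostDeriv]
  rw [sum_comm (s := (univ : Finset (Fin T)))]
  simp only [← sum_add_distrib, ← sum_neg_distrib, Pi.sub_apply]
  exact sum_congr rfl fun i _ => sum_congr rfl fun t _ => by ring

/-- Two profiles that both satisfy the first-order conditions against each other coincide. -/
theorem eq_of_userCostDeriv_nonneg {w r : Fin T → ℝ} (hw : ∀ t, 0 < w t)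
    {ν ν' : Fin n → Fin T → ℝ} (h : ∀ i, 0 ≤ userCostDeriv w r i ν (ν' i - ν i))
    (h' : ∀ i, 0 ≤ userCostDeriv w r i ν' (ν i - ν' i)) : ν' = ν := by
  by_contra hne
  obtain ⟨i, hi⟩ := Function.ne_iff.mp hne
  have hsum := sum_userCostDeriv_add w r ν ν'
  have h₁ := sum_nonneg fun i (_ : i ∈ univ) => add_nonneg (h i) (h' i)
  have h₂ : 0 ≤ ∑ t, (∑ j, ν j t - ∑ j, ν' j t) ^ 2 / w t :=
    sum_nonneg fun t _ => div_nonneg (sq_nonneg _) (hw t).le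
  have h₃ : 0 < ∑ i, ∑ t, (ν' i t - ν i t) ^ 2 / w t :=
    sum_pos' (fun i _ => sum_nonneg fun t _ => div_nonneg (sq_nonneg _) (hw t).le)
      ⟨i, mem_univ i, sum_sq_div_pos hw hi⟩
  linarith

/-- A minimizer of the potential over a product of compact strategy sets is an equilibrium. -/
theorem exists_equilibrium (w r : Fin T → ℝ) {s : Fin n → Set (Fin T → ℝ)}
    (hs : ∀ i, IsCompact (s i)) (hne : ∀ i, (s i).Nonempty) :
    ∃ ν : Fin n → Fin T → ℝ, (∀ i, ν i ∈ s i) ∧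
      ∀ i, ∀ x ∈ s i, userCost w r i ν ≤ userCost w r i (Function.update ν i x) := by
  obtain ⟨ν, hν, hmin⟩ := (isCompact_univ_pi hs).exists_isMinOn
    (Set.univ_pi_nonempty_iff.mpr hne) (continuous_potential w r).continuousOn
  refine ⟨ν, fun i => hν i trivial, fun i x hx => ?_⟩
  have hmem : Function.update ν i x ∈ Set.univ.pi s := by
    intro j _
    by_cases hj : j = i
    · subst hj
      simpa using hx
    · simpa [hj] using hν j trivial
  have h := isMinOn_iff.mp hmin _ hmem
  linarith [potential_update w r i ν x]

end BoxGame

/-- If `w̃ t > 0` for all `t` and `ν^max i ≥ g i / T` for all `i`, the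
box-constrained game admits a Nash equilibrium, this equilibrium is unique, and it
is a strict Nash equilibrium. -/
theorem stmt7
    (n T : ℕ) (hn : 1 ≤ n) (hT : 1 ≤ T)
    (wt rt : Fin T → ℝ) (g : Fin n → ℝ) (hg : ∀ i, 0 < g i)
    (νmax : Fin n → ℝ)
    (gN : ℝ) (hgN : gN = ∑ i, g i)
    (Adm : Fin n → (Fin T → ℝ) → Prop)
    (hAdm : ∀ i x, Adm i x ↔ ((∑ t, x t = g i) ∧ ∀ t, 0 ≤ x t ∧ x t ≤ νmax i))
    (cost : Fin n → (Fin n → Fin T → ℝ) → ℝ)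
    (hcost : ∀ i ν, cost i ν = ∑ t, (((∑ j, ν j t) + rt t) / wt t) * ν i t)
    (hpos : ∀ t, 0 < wt t)
    (hνmax : ∀ i, νmax i ≥ g i / (T : ℝ)) :
    ∃ ν : Fin n → Fin T → ℝ,
      (∀ i, Adm i (ν i)) ∧
      (∀ i x, Adm i x → cost i (Function.update ν i x) ≥ cost i ν) ∧
      (∀ ν' : Fin n → Fin T → ℝ,
        (∀ i, Adm i (ν' i)) →
        (∀ i x, Adm i x → cost i (Function.update ν' i x) ≥ cost i ν') →
        ν' = ν) ∧
      (∀ i x, Adm i x → x ≠ ν i →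
        cost i (Function.update ν i x) > cost i ν) := by
  obtain rfl : cost = BoxGame.userCost wt rt := by
    funext i ν
    exact hcost i ν
  obtain rfl : Adm = fun i x => x ∈ BoxGame.strategies T (g i) (νmax i) := by
    funext i x
    exact propext (hAdm i x)
  obtain ⟨ν, hν, hmin⟩ := BoxGame.exists_equilibrium wt rt
    (fun i => BoxGame.isCompact_strategies (T := T) (g i) (νmax i))
    (fun i => BoxGame.strategies_nonempty hT (hg i).le (hνmax i))
  have hderiv : ∀ i, ∀ x ∈ BoxGame.strategies T (g i) (νmax i),
      0 ≤ BoxGame.userCostDeriv wt rt i ν (x - ν i) := fun i x hx =>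
    BoxGame.userCostDeriv_nonneg (BoxGame.convex_strategies _ _) (hν i) (hmin i) hx
  refine ⟨ν, hν, hmin, fun ν' hν' hmin' => ?_, fun i x hx hne => ?_⟩
  · exact BoxGame.eq_of_userCostDeriv_nonneg hpos (fun i => hderiv i _ (hν' i)) fun i =>
      BoxGame.userCostDeriv_nonneg (BoxGame.convex_strategies _ _) (hν' i) (hmin' i) (hν i)
  · rw [BoxGame.userCost_update]
    linarith [hderiv i x hx, BoxGame.sum_sq_div_pos hpos hne]
end

section
/- If ∑_t ν i t = g i, then u_i(ν) = dᵀ C d + μᵀ d + (h τ) · g i + (g i)²/w̃ τ. -/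
open Matrix

/-- If `∑_t ν i t = g i`, then user `i`'s cost can be written as the
quadratic form `dᵀ C d + μᵀ d + (h τ)·g i + (g i)²/w̃ τ`, where `τ` is the last time
slot, `d` collects the first `T−1` components of `ν i`, `C = D + (1/w̃ τ)·𝟙𝟙ᵀ`, and
`μ_t = h t − h τ − 2·g i/w̃ τ`. -/
theorem stmt8
    (n T : ℕ) (hn : 1 ≤ n) (hT : 2 ≤ T)
    (wt rt : Fin T → ℝ) (hw : ∀ t, 0 < wt t)
    (g : Fin n → ℝ)
    (ν : Fin n → Fin T → ℝ)
    (i : Fin n)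
    (τ : Fin T) (hτ : τ = ⟨T - 1, by omega⟩)
    (emb : Fin (T - 1) → Fin T) (hemb : emb = Fin.castLE (Nat.sub_le T 1))
    (h : Fin T → ℝ)
    (hh : ∀ t, h t = ((∑ j ∈ Finset.univ.erase i, ν j t) + rt t) / wt t)
    (d : Fin (T - 1) → ℝ) (hd : ∀ t, d t = ν i (emb t))
    (C : Matrix (Fin (T - 1)) (Fin (T - 1)) ℝ)
    (hC : C = Matrix.diagonal (fun t => 1 / wt (emb t)) +
      (1 / wt τ) • Matrix.of (fun _ _ => (1 : ℝ)))
    (μ : Fin (T - 1) → ℝ)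
    (hμ : ∀ t, μ t = h (emb t) - h τ - 2 * g i / wt τ)
    (hsum : ∑ t, ν i t = g i) :
    ∑ t, (((∑ j, ν j t) + rt t) / wt t) * ν i t =
      d ⬝ᵥ C.mulVec d + μ ⬝ᵥ d + h τ * g i + (g i) ^ 2 / wt τ := by
  have hcost : ∀ t, (((∑ j, ν j t) + rt t) / wt t) * ν i t =
      ν i t * (1 / wt t * ν i t) + h t * ν i t := by
    intro t
    rw [hh, ← Finset.add_sum_erase _ _ (Finset.mem_univ i)]
    ring
  have hsplit : ∀ f : Fin T → ℝ, ∑ t, f t = ∑ t, f (emb t) + f τ := by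
    obtain ⟨m, rfl⟩ : ∃ m, T = m + 1 := ⟨T - 1, by omega⟩
    subst hτ hemb
    exact Fin.sum_univ_castSucc
  have hquad : d ⬝ᵥ C.mulVec d =
      ∑ t, d t * (1 / wt (emb t) * d t) + 1 / wt τ * (∑ t, d t) ^ 2 := by
    have hones : (Matrix.of fun _ _ => (1 : ℝ)).mulVec d = fun _ : Fin (T - 1) => ∑ t, d t := by
      ext s
      simp [Matrix.mulVec, dotProduct]
    rw [hC, Matrix.add_mulVec, Matrix.smul_mulVec, hones, dotProduct_add, dotProduct_smul]
    simp only [dotProduct, Matrix.mulVec_diagonal, smul_eq_mul, ← Finset.sum_mul]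
    ring
  have hlin : μ ⬝ᵥ d = ∑ t, h (emb t) * d t - (h τ + 2 * g i / wt τ) * ∑ t, d t := by
    rw [dotProduct, Finset.mul_sum, ← Finset.sum_sub_distrib]
    refine Finset.sum_congr rfl fun t _ => ?_
    rw [hμ]
    ring
  rw [hsplit] at hsum
  simp only [← hd] at hsum
  rw [Finset.sum_congr rfl fun t _ => hcost t, hsplit, Finset.sum_add_distrib, hquad, hlin]
  simp only [← hd]
  rw [← hsum]
  ring
end

section
/- Assume w̃ t > 0 for every t ∈ Fin T. Fix a user i and strategies ν j : Fin T → ℝ for all j ≠ i with ∑_t ν j t = g j. Define ν̄ : Fin T → ℝ by ν̄ t = −(1/2) · ∑_{j≠i} ν j t + ((g_N + g i + R)/(2·W)) · w̃ t − (1/2) · r̃ t. Then ∑_t ν̄ t = g i, and for every x : Fin T → ℝ with ∑_t x t = g i and x ≠ ν̄, ∑_t ((x t + ∑_{j≠i} ν j t + r̃ t)/w̃ t) · x t > ∑_t ((ν̄ t + ∑_{j≠i} ν j t + r̃ t)/w̃ t) · ν̄ t; that is, ν̄ is the unique minimizer of user i's cost over the hyperplane {x : ∑_t x t = g i} when the other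 users' strategies are fixed. -/
/-- A point satisfying the first-order condition `2 y + a = l w` strictly minimizes the separable
quadratic cost `∑ ((x + a) / w) x` among all points with the same coordinate sum. -/
theorem sum_div_mul_lt_of_stationary {ι : Type*} [Fintype ι] {w a x y : ι → ℝ} {l : ℝ}
    (hw : ∀ t, 0 < w t) (hy : ∀ t, 2 * y t + a t = l * w t)
    (hsum : ∑ t, x t = ∑ t, y t) (hne : x ≠ y) :
    ∑ t, ((y t + a t) / w t) * y t < ∑ t, ((x t + a t) / w t) * x t := by
  have hterm (t : ι) : ((x t + a t) / w t) * x t =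
      ((y t + a t) / w t) * y t + (x t - y t) ^ 2 / w t + l * (x t - y t) := by
    have hwt := (hw t).ne'
    have ha : a t = l * w t - 2 * y t := by linarith [hy t]
    rw [ha]
    field_simp
    ring
  have hlin : ∑ t, l * (x t - y t) = 0 := by
    rw [← Finset.mul_sum, Finset.sum_sub_distrib, hsum, sub_self, mul_zero]
  have hquad : 0 < ∑ t, (x t - y t) ^ 2 / w t := by
    obtain ⟨t, ht⟩ := Function.ne_iff.mp hne
    exact Finset.sum_pos' (fun s _ => div_nonneg (sq_nonneg _) (hw s).le)
      ⟨t, Finset.mem_univ t, div_pos (sq_pos_of_ne_zero (sub_ne_zero.mpr ht)) (hw t)⟩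
  simp only [hterm, Finset.sum_add_distrib, hlin]
  linarith

/-- With the other users' strategies fixed (each summing to its total
demand), the strategy
`ν̄ t = −(1/2)·∑_{j≠i} ν j t + ((g_N + g i + R)/(2W))·w̃ t − (1/2)·r̃ t`
sums to `g i` and is the unique minimizer of user `i`'s cost over the hyperplane
`{x : ∑_t x t = g i}`. -/
theorem stmt10
    (n T : ℕ) (hn : 1 ≤ n) (hT : 1 ≤ T)
    (wt rt : Fin T → ℝ) (g : Fin n → ℝ) (hg : ∀ i, 0 < g i)
    (gN W R : ℝ) (hgN : gN = ∑ i, g i) (hW : W = ∑ t, wt t) (hR : R = ∑ t, rt t)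
    (hpos : ∀ t, 0 < wt t)
    (i : Fin n)
    (ν : Fin n → Fin T → ℝ)
    (hν : ∀ j, j ≠ i → ∑ t, ν j t = g j)
    (νbar : Fin T → ℝ)
    (hνbar : ∀ t, νbar t = -(1 / 2) * (∑ j ∈ Finset.univ.erase i, ν j t) +
      ((gN + g i + R) / (2 * W)) * wt t - (1 / 2) * rt t) :
    (∑ t, νbar t = g i) ∧
    ∀ x : Fin T → ℝ, (∑ t, x t = g i) → x ≠ νbar →
      ∑ t, ((x t + (∑ j ∈ Finset.univ.erase i, ν j t) + rt t) / wt t) * x t >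
      ∑ t, ((νbar t + (∑ j ∈ Finset.univ.erase i, ν j t) + rt t) / wt t) * νbar t := by
  have hWpos : 0 < W := by
    rw [hW]
    exact Finset.sum_pos (fun t _ => hpos t) ⟨⟨0, hT⟩, Finset.mem_univ _⟩
  have hothers : ∑ t, ∑ j ∈ Finset.univ.erase i, ν j t = gN - g i := by
    rw [Finset.sum_comm, Finset.sum_congr rfl fun j hj => hν j (Finset.ne_of_mem_erase hj), hgN,
      ← Finset.add_sum_erase _ g (Finset.mem_univ i), add_sub_cancel_left]
  have hsum : ∑ t, νbar t = g i := by
    simp only [hνbar, Finset.sum_sub_distrib, Finset.sum_add_distrib, ← Finset.mul_sum, hothers,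
      ← hW, ← hR]
    field_simp
    ring
  refine ⟨hsum, fun x hx hne => ?_⟩
  simp only [add_assoc]
  refine sum_div_mul_lt_of_stationary (l := (gN + g i + R) / W) hpos (fun t => ?_)
    (hx.trans hsum.symm) hne
  rw [hνbar t]
  field_simp
  ring
end

section
/- Assume w̃ t > 0 for every t ∈ Fin T. Then the linear system ν i t + ∑_j ν j t = ((g_N + g i + R)/W) · w̃ t − r̃ t (required for every user i and every slot t) has exactly one solution ν : Fin n → Fin T → ℝ, namely ν = ν*; in particular this unique solution automatically satisfies ∑_t ν i t = g i for every i. -/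
/-- The matrix `1 + J`, with `J` the all-ones matrix, is injective. -/
theorem eq_of_add_sum_eq_add_sum {ι : Type*} [Fintype ι] {x y : ι → ℝ}
    (h : ∀ i, x i + ∑ j, x j = y i + ∑ j, y j) : x = y := by
  have hsum : ∑ i, (x i + ∑ j, x j) = ∑ i, (y i + ∑ j, y j) :=
    Finset.sum_congr rfl fun i _ => h i
  simp only [Finset.sum_add_distrib, Finset.sum_const, nsmul_eq_mul] at hsum
  have hcard : (0 : ℝ) < 1 + (Finset.univ : Finset ι).card := by positivity
  have hS : ∑ j, x j = ∑ j, y j := mul_left_cancel₀ hcard.ne' (by linarith)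
  funext i
  linarith [h i]

/-- If `w̃ t > 0` for all `t`, the linear system
`ν i t + ∑_j ν j t = ((g_N + g i + R)/W)·w̃ t − r̃ t` (for every user `i` and slot `t`)
has exactly one solution, namely `ν = ν*`, and this solution automatically satisfies
`∑_t ν i t = g i` for every `i`. -/
theorem stmt11
    (n T : ℕ) (hn : 1 ≤ n) (hT : 1 ≤ T)
    (wt rt : Fin T → ℝ) (g : Fin n → ℝ) (hg : ∀ i, 0 < g i)
    (gN W R : ℝ) (hgN : gN = ∑ i, g i) (hW : W = ∑ t, wt t) (hR : R = ∑ t, rt t)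
    (hpos : ∀ t, 0 < wt t)
    (νstar : Fin n → Fin T → ℝ)
    (hνstar : ∀ i t, νstar i t =
      (g i / W) * wt t + (R * wt t - W * rt t) / (((n : ℝ) + 1) * W)) :
    (∀ i t, νstar i t + (∑ j, νstar j t) = ((gN + g i + R) / W) * wt t - rt t) ∧
    (∀ ν : Fin n → Fin T → ℝ,
      (∀ i t, ν i t + (∑ j, ν j t) = ((gN + g i + R) / W) * wt t - rt t) →
      ν = νstar) ∧
    (∀ i, ∑ t, νstar i t = g i) := by
  have hWpos : 0 < W := hW ▸ Finset.sum_pos (fun t _ => hpos t) ⟨⟨0, hT⟩, Finset.mem_univ _⟩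
  have hn1 : (n : ℝ) + 1 ≠ 0 := by positivity
  have hsol : ∀ i t, νstar i t + (∑ j, νstar j t) = ((gN + g i + R) / W) * wt t - rt t := by
    intro i t
    simp only [hνstar, Finset.sum_add_distrib, ← Finset.sum_mul, ← Finset.sum_div, ← hgN,
      Finset.sum_const, Finset.card_univ, Fintype.card_fin, nsmul_eq_mul]
    field_simp
    ring
  refine ⟨hsol, fun ν hν => ?_, fun i => ?_⟩
  · funext i t
    exact congrFun (eq_of_add_sum_eq_add_sum (x := fun j => ν j t) (y := fun j => νstar j t)
      fun j => (hν j t).trans (hsol j t).symm) i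
  · simp only [hνstar, Finset.sum_add_distrib, ← Finset.mul_sum, ← Finset.sum_div,
      Finset.sum_sub_distrib, ← hW, ← hR]
    field_simp
    ring
end

section
/- Assume w̃ t > 0 for every t ∈ Fin T. A feasible profile ν is a Nash equilibrium of the equality-constrained game if and only if for every user i and every slot t, ν i t = −(1/2) · ∑_{j≠i} ν j t + ((g_N + g i + R)/(2·W)) · w̃ t − (1/2) · r̃ t. -/
/-- The separable cost `∑ t, (x t + a t) / w t * x t` exceeds its value at a point `y` with
constant marginal cost `(2 * y t + a t) / w t = 2 * c` by a weighted squared distance, along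
allocations of the same total. -/
lemma sum_cost_eq_add_sum_sq {ι : Type*} [Fintype ι] {w a x y : ι → ℝ} {c : ℝ}
    (hw : ∀ t, 0 < w t) (hy : ∀ t, y t = -(1 / 2) * a t + c * w t)
    (hxy : ∑ t, x t = ∑ t, y t) :
    ∑ t, (x t + a t) / w t * x t =
      ∑ t, (y t + a t) / w t * y t + ∑ t, (x t - y t) ^ 2 / w t := by
  have key : ∀ t, (x t + a t) / w t * x t =
      (y t + a t) / w t * y t + (x t - y t) ^ 2 / w t + 2 * c * (x t - y t) := by
    intro t
    have := (hw t).ne'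
    rw [hy t]
    field_simp
    ring
  rw [Finset.sum_congr rfl fun t _ => key t, Finset.sum_add_distrib, Finset.sum_add_distrib,
    ← Finset.mul_sum, Finset.sum_sub_distrib, hxy, sub_self, mul_zero, add_zero]

/-- On allocations of the same total, the separable cost `∑ t, (x t + a t) / w t * x t` is
minimized exactly at the point with constant marginal cost. -/
lemma forall_sum_cost_le_iff {ι : Type*} [Fintype ι] {w a x y : ι → ℝ} {c : ℝ}
    (hw : ∀ t, 0 < w t) (hy : ∀ t, y t = -(1 / 2) * a t + c * w t)
    (hxy : ∑ t, x t = ∑ t, y t) :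
    (∀ z : ι → ℝ, ∑ t, z t = ∑ t, y t →
      ∑ t, (x t + a t) / w t * x t ≤ ∑ t, (z t + a t) / w t * z t) ↔ ∀ t, x t = y t := by
  have hnonneg : ∀ z : ι → ℝ, ∀ t ∈ Finset.univ, 0 ≤ (z t - y t) ^ 2 / w t :=
    fun z t _ => div_nonneg (sq_nonneg _) (hw t).le
  constructor
  · intro h t
    have hle := h y rfl
    rw [sum_cost_eq_add_sum_sq hw hy hxy] at hle
    have hzero : ∑ t, (x t - y t) ^ 2 / w t = 0 :=
      le_antisymm (by linarith) (Finset.sum_nonneg (hnonneg x))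
    have ht := (Finset.sum_eq_zero_iff_of_nonneg (hnonneg x)).1 hzero t (Finset.mem_univ t)
    rw [div_eq_zero_iff, or_iff_left (hw t).ne', sq_eq_zero_iff] at ht
    exact sub_eq_zero.1 ht
  · intro h z hz
    obtain rfl : x = y := funext h
    rw [sum_cost_eq_add_sum_sq hw hy hz]
    exact le_add_of_nonneg_right (Finset.sum_nonneg (hnonneg z))

/-- If `w̃ t > 0` for all `t`, a feasible profile `ν` is a Nash
equilibrium of the equality-constrained game iff for every user `i` and slot `t`,
`ν i t = −(1/2)·∑_{j≠i} ν j t + ((g_N + g i + R)/(2W))·w̃ t − (1/2)·r̃ t`. -/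
theorem stmt12
    (n T : ℕ) (hn : 1 ≤ n) (hT : 1 ≤ T)
    (wt rt : Fin T → ℝ) (g : Fin n → ℝ) (hg : ∀ i, 0 < g i)
    (gN W R : ℝ) (hgN : gN = ∑ i, g i) (hW : W = ∑ t, wt t) (hR : R = ∑ t, rt t)
    (cost : Fin n → (Fin n → Fin T → ℝ) → ℝ)
    (hcost : ∀ i ν, cost i ν = ∑ t, (((∑ j, ν j t) + rt t) / wt t) * ν i t)
    (hpos : ∀ t, 0 < wt t)
    (ν : Fin n → Fin T → ℝ)
    (hfeas : ∀ i, ∑ t, ν i t = g i) :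
    (∀ i (x : Fin T → ℝ), (∑ t, x t = g i) →
      cost i (Function.update ν i x) ≥ cost i ν) ↔
    (∀ i t, ν i t = -(1 / 2) * (∑ j ∈ Finset.univ.erase i, ν j t) +
      ((gN + g i + R) / (2 * W)) * wt t - (1 / 2) * rt t) := by
  have hWpos : 0 < W := by
    rw [hW]
    exact Finset.sum_pos (fun t _ => hpos t) ⟨⟨0, hT⟩, Finset.mem_univ _⟩
  refine forall_congr' fun i => ?_
  set a : Fin T → ℝ := fun t => (∑ j ∈ Finset.univ.erase i, ν j t) + rt t with ha
  set c : ℝ := (gN + g i + R) / (2 * W) with hc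
  have hupdate : ∀ x : Fin T → ℝ,
      cost i (Function.update ν i x) = ∑ t, (x t + a t) / wt t * x t := by
    intro x
    rw [hcost]
    refine Finset.sum_congr rfl fun t _ => ?_
    have hsum : ∑ j ∈ Finset.univ.erase i, Function.update ν i x j t =
        ∑ j ∈ Finset.univ.erase i, ν j t :=
      Finset.sum_congr rfl fun j hj => by
        rw [Function.update_of_ne (Finset.ne_of_mem_erase hj)]
    rw [← Finset.add_sum_erase _ _ (Finset.mem_univ i), hsum, Function.update_self, add_assoc]
  have hasum : ∑ t, a t = gN - g i + R := by
    rw [ha, Finset.sum_add_distrib, Finset.sum_comm, Finset.sum_congr rfl fun j _ => hfeas j,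
      Finset.sum_erase_eq_sub (Finset.mem_univ i), hgN, hR]
  have hysum : ∑ t, (-(1 / 2) * a t + c * wt t) = g i := by
    rw [Finset.sum_add_distrib, ← Finset.mul_sum, ← Finset.mul_sum, hasum, ← hW, hc]
    field_simp
    ring
  have hmin := forall_sum_cost_le_iff (x := ν i) (a := a) hpos (fun _ => rfl)
    ((hfeas i).trans hysum.symm)
  rw [hysum] at hmin
  have hself : cost i ν = ∑ t, (ν i t + a t) / wt t * ν i t := by
    rw [← hupdate, Function.update_eq_self]
  simp only [hupdate, hself, ge_iff_le]
  refine hmin.trans (forall_congr' fun t => ?_)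
  have hrhs : -(1 / 2) * a t + c * wt t = -(1 / 2) * (∑ j ∈ Finset.univ.erase i, ν j t) +
      c * wt t - (1 / 2) * rt t := by
    rw [ha]
    ring
  rw [hrhs]
end
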